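/- arXiv:1401.4907 — 2 statements merged into one kernel-verified Lean document; each statement's English description precedes it below -/
import Mathlib

section
/- Fix R > 0, α > 1, T > 1 and positive ratios β, δ, μ satisfying min(T/4, 1/(3μ), 3β/(2μ)) > 10, and for ρ_r > 0 let Θ(ρ_r) := (α, ρ_r, β·ρ_r, δ·ρ_r, μ·ρ_r, T). Suppose 0 < ρ_{r1} < ρ_{r2} and for each i ∈ {1,2} the conditions (D.1) ρ_{ri} > α/(2δ), (D.2) ρ_{ri} > (3α/(4(1+β)²·R))·g(4R/(3·K_max(Θ(ρ_{ri}))))², and (D.3) ρ_{ri} < (α/(1+β)²)·g(R)²/R hold. Then ρ_{r1}·ζ'_csi(R, Θ(ρ_{r1})) < ρ_{r2}·ζ'_csi(R, Θ(ρ_{r2})); i.e., the unnormalized optimal energy efficiency of the ideal perfect-CSI system, which is proportional to G_c·ζ'_csi where the channel gain G_c is proportional to ρ_r, strictly increases with ρ_r (equivalently, strictly decreases with decreasing channel gain). -/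
open Real

/-- Uplink SINR-like quantity γ_u(M,K,τ,R,T). -/
noncomputable def gammaU (M K τ R T : ℝ) : ℝ :=
  ((K + τ) * ((2:ℝ) ^ (R / (K * (1 - τ / T))) - 1)) / (2 * τ * (M - K)) +
    Real.sqrt ((((K + τ) * ((2:ℝ) ^ (R / (K * (1 - τ / T))) - 1)) / (2 * τ * (M - K))) ^ 2 +
      ((2:ℝ) ^ (R / (K * (1 - τ / T))) - 1) / (τ * (M - K)))

/-- Total normalized power consumption P(M,K,τ,R,Θ). -/
noncomputable def Ptot (M K τ R α ρr ρd ρs ρ0 T : ℝ) : ℝ :=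
  α * K * gammaU M K τ R T + ρs + K * (ρd + (8/3) * K ^ 2 * ρ0 / T) +
    M * (ρr + 2 * K * ρ0 + 4 * K ^ 2 * ρ0 / T)

/-- Optimal normalized energy efficiency ζ*_zf(R,Θ) (integer optimization). -/
noncomputable def zetaZfStar (R α ρr ρd ρs ρ0 T : ℝ) : ℝ :=
  R / sInf {p : ℝ | ∃ M K τ : ℤ, 1 ≤ K ∧ K ≤ τ ∧ (τ : ℝ) < T ∧ K < M ∧
    p = Ptot (M : ℝ) (K : ℝ) (τ : ℝ) R α ρr ρd ρs ρ0 T}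

/-- Maximum number of users K_max(Θ). -/
noncomputable def Kmax (ρr ρd ρ0 T : ℝ) : ℝ :=
  min (T / 4) (min (ρr / (3 * ρ0)) (3 * ρd / (2 * ρ0)))

/-- The function g(x). -/
noncomputable def gfun (x : ℝ) : ℝ :=
  Real.sqrt (x / ((2:ℝ) ^ x - 1)) * ((2:ℝ) ^ x * x * Real.log 2 - (2:ℝ) ^ x + 1)

/-- Ideal (perfect CSI) power consumption P_csi(M,K,R,Θ). -/
noncomputable def Pcsi (M K R α ρr ρd ρs : ℝ) : ℝ :=
  α * K * ((2:ℝ) ^ (R / K) - 1) / (M - K) + M * ρr + K * ρd + ρs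

/-- Relaxed (real-valued) optimal EE ζ'_zf(R,Θ) with K ≤ K_max(Θ). -/
noncomputable def zetaZfPrime (R α ρr ρd ρs ρ0 T : ℝ) : ℝ :=
  R / sInf {p : ℝ | ∃ M K τ : ℝ, 1 ≤ K ∧ K ≤ Kmax ρr ρd ρ0 T ∧ K ≤ τ ∧ τ < T ∧ K < M ∧
    p = Ptot M K τ R α ρr ρd ρs ρ0 T}

/-- Optimal EE of the ideal perfect-CSI system ζ'_csi(R,Θ). -/
noncomputable def zetaCsiPrime (R α ρr ρd ρs ρ0 T : ℝ) : ℝ :=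
  R / sInf {p : ℝ | ∃ M K : ℝ, 1 ≤ K ∧ K ≤ Kmax ρr ρd ρ0 T ∧ K < M ∧
    p = Pcsi M K R α ρr ρd ρs}

/-- Relaxed optimal EE with the number of users fixed to K. -/
noncomputable def zetaZfFixedK (K R α ρr ρd ρs ρ0 T : ℝ) : ℝ :=
  R / sInf {p : ℝ | ∃ M τ : ℝ, K < M ∧ K ≤ τ ∧ τ < T ∧
    p = Ptot M K τ R α ρr ρd ρs ρ0 T}

lemma mul_log_two_le_mul_two_rpow_div_sub_one {R K : ℝ} (hK : 0 < K) :
    R * Real.log 2 ≤ K * ((2 : ℝ) ^ (R / K) - 1) := by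
  have h := Real.add_one_le_exp (Real.log 2 * (R / K))
  rw [← Real.rpow_def_of_pos two_pos] at h
  calc R * Real.log 2 = K * (Real.log 2 * (R / K)) := by field_simp
    _ ≤ _ := mul_le_mul_of_nonneg_left (by linarith) hK.le

lemma two_mul_sqrt_mul_le_div_add_mul {c a t : ℝ} (hc : 0 ≤ c) (ha : 0 ≤ a) (ht : 0 < t) :
    2 * √(a * c) ≤ c / t + a * t := by
  have h₁ : √(a * c) = √(c / t) * √(a * t) := by
    rw [← Real.sqrt_mul (by positivity)]
    congr 1
    field_simp
  have h₂ := two_mul_le_add_sq √(c / t) √(a * t)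
  rw [Real.sq_sqrt (by positivity), Real.sq_sqrt (by positivity)] at h₂
  linarith

/-- Shrinking the antenna surplus `M - K` by `s` while dividing `ρ` by `s ^ 2` scales the
first two terms of the power per unit of `ρ` by `s`. -/
lemma sq_mul_Pcsi_rescale {M K R α β δ ρ s : ℝ} (hs : s ≠ 0) (hM : K < M) :
    s ^ 2 * ρ * Pcsi (K + s * (M - K)) K R α ρ (β * ρ) (δ * ρ) =
      ρ * Pcsi M K R α (s ^ 2 * ρ) (β * (s ^ 2 * ρ)) (δ * (s ^ 2 * ρ)) -
        (1 - s) * ρ * (α * K * ((2 : ℝ) ^ (R / K) - 1) / (M - K) + s ^ 2 * ρ * (M - K)) := by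
  have ht : M - K ≠ 0 := (sub_pos.2 hM).ne'
  unfold Pcsi
  rw [add_sub_cancel_left]
  field_simp
  ring

lemma le_Pcsi {M K R α ρr ρd ρs : ℝ} (hR : 0 ≤ R) (hα : 0 ≤ α) (hr : 0 ≤ ρr) (hd : 0 ≤ ρd)
    (hK : 0 < K) (hM : K < M) : ρs ≤ Pcsi M K R α ρr ρd ρs := by
  have h₁ : (0 : ℝ) ≤ 2 ^ (R / K) - 1 :=
    sub_nonneg.2 (Real.one_le_rpow one_le_two (by positivity))
  have h₂ : 0 < M - K := sub_pos.2 hM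
  have h₃ : 0 < M := hK.trans hM
  unfold Pcsi
  have : 0 ≤ α * K * ((2 : ℝ) ^ (R / K) - 1) / (M - K) + M * ρr + K * ρd := by positivity
  linarith

lemma Kmax_scale {ρ β μ T : ℝ} (hρ : 0 < ρ) :
    Kmax ρ (β * ρ) (μ * ρ) T = min (T / 4) (min (1 / (3 * μ)) (3 * β / (2 * μ))) := by
  unfold Kmax
  congr 2
  · field_simp
  · field_simp

/-- the unnormalized optimal EE of the ideal perfect-CSI system, i.e.
ρ_r·ζ'_csi(R,Θ(ρ_r)), strictly increases with ρ_r (Theorem 5). -/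
theorem stmt_17 (R α T β δ μ ρr₁ ρr₂ : ℝ)
    (hR : 0 < R) (hα : 1 < α) (hT : 1 < T)
    (hβ : 0 < β) (hδ : 0 < δ) (hμ : 0 < μ)
    (hcond : 10 < min (T / 4) (min (1 / (3 * μ)) (3 * β / (2 * μ))))
    (hρr₁ : 0 < ρr₁) (h12 : ρr₁ < ρr₂)
    (hD1a : ρr₁ > α / (2 * δ))
    (hD2a : ρr₁ > 3 * α / (4 * (1 + β) ^ 2 * R) *
      (gfun (4 * R / (3 * Kmax ρr₁ (β * ρr₁) (μ * ρr₁) T))) ^ 2)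
    (hD3a : ρr₁ < α / (1 + β) ^ 2 * (gfun R) ^ 2 / R)
    (hD1b : ρr₂ > α / (2 * δ))
    (hD2b : ρr₂ > 3 * α / (4 * (1 + β) ^ 2 * R) *
      (gfun (4 * R / (3 * Kmax ρr₂ (β * ρr₂) (μ * ρr₂) T))) ^ 2)
    (hD3b : ρr₂ < α / (1 + β) ^ 2 * (gfun R) ^ 2 / R) :
    ρr₁ * zetaCsiPrime R α ρr₁ (β * ρr₁) (δ * ρr₁) (μ * ρr₁) T <
      ρr₂ * zetaCsiPrime R α ρr₂ (β * ρr₂) (δ * ρr₂) (μ * ρr₂) T := by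
  have hρr₂ : 0 < ρr₂ := hρr₁.trans h12
  unfold zetaCsiPrime
  rw [Kmax_scale hρr₁, Kmax_scale hρr₂]
  set κ := min (T / 4) (min (1 / (3 * μ)) (3 * β / (2 * μ)))
  set S : ℝ → Set ℝ := fun ρ ↦
    {p | ∃ M K : ℝ, 1 ≤ K ∧ K ≤ κ ∧ K < M ∧ p = Pcsi M K R α ρ (β * ρ) (δ * ρ)}
  change ρr₁ * (R / sInf (S ρr₁)) < ρr₂ * (R / sInf (S ρr₂))
  have hne (ρ : ℝ) : (S ρ).Nonempty := ⟨_, 2, 1, le_rfl, by linarith, one_lt_two, rfl⟩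
  have hlb {ρ : ℝ} (hρ : 0 < ρ) : ∀ p ∈ S ρ, δ * ρ ≤ p := by
    rintro p ⟨M, K, hK, -, hM, rfl⟩
    exact le_Pcsi hR.le (by linarith) hρ.le (by positivity) (by linarith) hM
  have hpos {ρ : ℝ} (hρ : 0 < ρ) : 0 < sInf (S ρ) :=
    (mul_pos hδ hρ).trans_le (le_csInf (hne ρ) (hlb hρ))
  obtain ⟨s, hs, hs1, rfl⟩ : ∃ s : ℝ, 0 < s ∧ s < 1 ∧ ρr₁ = s ^ 2 * ρr₂ := by
    refine ⟨√(ρr₁ / ρr₂), by positivity, ?_, ?_⟩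
    · rw [Real.sqrt_lt' one_pos, one_pow]
      exact (div_lt_one hρr₂).2 h12
    · rw [Real.sq_sqrt (by positivity), div_mul_cancel₀ _ hρr₂.ne']
  have hc : 0 < α * (R * Real.log 2) :=
    mul_pos (by linarith) (mul_pos hR (Real.log_pos one_lt_two))
  have hgap : 0 < (1 - s) * ρr₂ * (2 * √(s ^ 2 * ρr₂ * (α * (R * Real.log 2)))) := by
    have := sub_pos.2 hs1
    positivity
  have hle : (s ^ 2 * ρr₂ * sInf (S ρr₂) +
      (1 - s) * ρr₂ * (2 * √(s ^ 2 * ρr₂ * (α * (R * Real.log 2))))) / ρr₂ ≤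
        sInf (S (s ^ 2 * ρr₂)) := by
    refine le_csInf (hne _) ?_
    rintro p ⟨M, K, hK, hKκ, hM, rfl⟩
    have ht : 0 < M - K := sub_pos.2 hM
    have hmem : Pcsi (K + s * (M - K)) K R α ρr₂ (β * ρr₂) (δ * ρr₂) ∈ S ρr₂ :=
      ⟨_, K, hK, hKκ, lt_add_of_pos_right _ (mul_pos hs ht), rfl⟩
    have h₁ := mul_le_mul_of_nonneg_left (csInf_le ⟨_, hlb hρr₂⟩ hmem) hρr₁.le
    rw [sq_mul_Pcsi_rescale hs.ne' hM] at h₁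
    have h₂ : α * (R * Real.log 2) / (M - K) ≤
        α * K * ((2 : ℝ) ^ (R / K) - 1) / (M - K) := by
      rw [mul_assoc α K]
      exact div_le_div_of_nonneg_right (mul_le_mul_of_nonneg_left
        (mul_log_two_le_mul_two_rpow_div_sub_one (zero_lt_one.trans_le hK)) (by linarith)) ht.le
    have h₃ := two_mul_sqrt_mul_le_div_add_mul hc.le hρr₁.le ht
    have h₄ := mul_le_mul_of_nonneg_left (h₃.trans (add_le_add_left h₂ _))
      (mul_nonneg (sub_nonneg.2 hs1.le) hρr₂.le)
    rw [div_le_iff₀ hρr₂]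
    linarith
  rw [div_le_iff₀ hρr₂] at hle
  rw [← mul_div_assoc, ← mul_div_assoc, div_lt_div_iff₀ (hpos hρr₁) (hpos hρr₂)]
  have := mul_lt_mul_of_pos_left
    (show s ^ 2 * ρr₂ * sInf (S ρr₂) < sInf (S (s ^ 2 * ρr₂)) * ρr₂ by linarith) hR
  linarith
end

section
/- Fix R > 0, α > 1, T > 1 and positive ratios β, δ, μ satisfying min(T/4, 1/(3μ), 3β/(2μ)) > 10, and for ρ_r > 0 let Θ(ρ_r) := (α, ρ_r, β·ρ_r, δ·ρ_r, μ·ρ_r, T). For Θ = Θ(ρ_r) satisfying (D.1) ρ_r > α/(2δ), (D.2) ρ_r > (3α/(4(1+β)²·R))·g(4R/(3·K_max(Θ)))², and (D.3) ρ_r < (α/(1+β)²)·g(R)²/R, define K'_csi(R,Θ) := R/x'(R,Θ) and M'_csi(R,Θ) := K'_csi(R,Θ) + sqrt(K'_csi(R,Θ))·sqrt(α·(2^(R/K'_csi(R,Θ)) − 1)/ρ_r). Then if 0 < ρ_{r1} < ρ_{r2} and both Θ(ρ_{r1}) and Θ(ρ_{r2}) satisfy (D.1)–(D.3), one has K'_csi(R,Θ(ρ_{r1}))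 > K'_csi(R,Θ(ρ_{r2})) and M'_csi(R,Θ(ρ_{r1})) > M'_csi(R,Θ(ρ_{r2})); i.e., both the optimal number of users and the optimal number of antennas of the ideal perfect-CSI system strictly increase as ρ_r decreases. -/
open Real

/-- The factor `2 ^ x · x · ln 2 / (2 ^ x - 1) - 1` that governs the growth of `gfun`. -/
noncomputable def gfunFactor (x : ℝ) : ℝ :=
  (2:ℝ) ^ x * x * Real.log 2 / ((2:ℝ) ^ x - 1) - 1

lemma two_rpow_sub_one_pos {x : ℝ} (hx : 0 < x) : 0 < (2:ℝ) ^ x - 1 :=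
  sub_pos.mpr (Real.one_lt_rpow one_lt_two hx)

lemma gfunFactor_eq (x : ℝ) :
    gfunFactor x = x * Real.log 2 / (1 - Real.exp (-(x * Real.log 2))) - 1 := by
  have h2 : (2:ℝ) ^ x = Real.exp (x * Real.log 2) := by
    rw [Real.rpow_def_of_pos two_pos, mul_comm]
  unfold gfunFactor
  rw [h2, Real.exp_neg]
  have h3 : 1 - (Real.exp (x * Real.log 2))⁻¹ =
      (Real.exp (x * Real.log 2) - 1) / Real.exp (x * Real.log 2) := by
    field_simp
  rw [h3, div_div_eq_mul_div]
  ring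

lemma gfunFactor_pos {x : ℝ} (hx : 0 < x) : 0 < gfunFactor x := by
  rw [gfunFactor_eq x]
  have hy : 0 < x * Real.log 2 := mul_pos hx (Real.log_pos one_lt_two)
  have h1 : Real.exp (-(x * Real.log 2)) < 1 := Real.exp_lt_one_iff.mpr (by linarith)
  have h2 := Real.add_one_lt_exp (x := -(x * Real.log 2)) (by linarith)
  rw [sub_pos, one_lt_div (by linarith)]
  linarith

lemma div_one_sub_exp_neg_lt {y z : ℝ} (hy : 0 < y) (hyz : y < z) :
    y / (1 - Real.exp (-y)) < z / (1 - Real.exp (-z)) := by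
  have hz : 0 < z := hy.trans hyz
  have h1 : Real.exp (-y) < 1 := Real.exp_lt_one_iff.mpr (by linarith)
  have h2 : Real.exp (-z) < 1 := Real.exp_lt_one_iff.mpr (by linarith)
  have h := strictConvexOn_exp.2 (Set.mem_univ (-z)) (Set.mem_univ 0) (by linarith)
    (div_pos hy hz) (sub_pos.mpr ((div_lt_one hz).mpr hyz)) (by ring)
  have h3 : y / z * -z = -y := by field_simp
  simp only [smul_eq_mul, mul_zero, add_zero, Real.exp_zero, mul_one, h3] at h
  have h4 : z * Real.exp (-y) < y * Real.exp (-z) + (z - y) := by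
    calc z * Real.exp (-y) < z * (y / z * Real.exp (-z) + (1 - y / z)) :=
          mul_lt_mul_of_pos_left h hz
      _ = y * Real.exp (-z) + (z - y) := by field_simp
  rw [div_lt_div_iff₀ (by linarith) (by linarith)]
  linarith

lemma gfunFactor_strictMonoOn : StrictMonoOn gfunFactor (Set.Ioi 0) := by
  intro x hx z hz hxz
  have hl := Real.log_pos one_lt_two
  rw [gfunFactor_eq x, gfunFactor_eq z]
  exact sub_lt_sub_right (div_one_sub_exp_neg_lt (mul_pos hx hl) (by gcongr)) 1

lemma gfun_sq {x : ℝ} (hx : 0 < x) :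
    gfun x ^ 2 = x * ((2:ℝ) ^ x - 1) * gfunFactor x ^ 2 := by
  have hu := two_rpow_sub_one_pos hx
  unfold gfun gfunFactor
  rw [mul_pow, Real.sq_sqrt (div_pos hx hu).le]
  field_simp
  ring

lemma gfun_sq_strictMonoOn : StrictMonoOn (fun x => gfun x ^ 2) (Set.Ioi 0) := by
  intro x hx z hz hxz
  have hφ := gfunFactor_strictMonoOn hx hz hxz
  have hφ0 := gfunFactor_pos hx
  have hu := two_rpow_sub_one_pos hx
  have hlt : (2:ℝ) ^ x < (2:ℝ) ^ z := Real.rpow_lt_rpow_of_exponent_lt one_lt_two hxz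
  simp only [Set.mem_Ioi] at hx hz
  simp only [gfun_sq hx, gfun_sq hz]
  gcongr

/-- The excess of antennas over users at the stationary point, in closed form. -/
lemma sqrt_mul_sqrt_eq_of_gfun_eq {R α β ρ x : ℝ} (hR : 0 < R) (hα : 0 < α) (hβ : 0 < 1 + β)
    (hρ : 0 < ρ) (hx : 0 < x) (hg : gfun x ^ 2 = (1 + β) ^ 2 * (R * ρ / α)) :
    Real.sqrt (R / x) * Real.sqrt (α * ((2:ℝ) ^ x - 1) / ρ) =
      (1 + β) * R / (x * gfunFactor x) := by
  have hu := two_rpow_sub_one_pos hx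
  have hφ := gfunFactor_pos hx
  rw [gfun_sq hx] at hg
  rw [← Real.sqrt_mul (div_pos hR hx).le, Real.sqrt_eq_iff_mul_self_eq (by positivity)
    (by positivity)]
  field_simp at hg ⊢
  linear_combination hg

/-- both the optimal number of users and the optimal number of BS antennas
of the ideal perfect-CSI system strictly increase as ρ_r decreases (Theorem 6). -/
theorem stmt_18 (R α T β δ μ ρr₁ ρr₂ x₁ x₂ : ℝ)
    (hR : 0 < R) (hα : 1 < α) (hT : 1 < T)
    (hβ : 0 < β) (hδ : 0 < δ) (hμ : 0 < μ)
    (hcond : 10 < min (T / 4) (min (1 / (3 * μ)) (3 * β / (2 * μ))))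
    (hρr₁ : 0 < ρr₁) (h12 : ρr₁ < ρr₂)
    (hx₁ : 0 < x₁) (hgx₁ : gfun x₁ = (1 + β) * Real.sqrt (R * ρr₁ / α))
    (hx₂ : 0 < x₂) (hgx₂ : gfun x₂ = (1 + β) * Real.sqrt (R * ρr₂ / α))
    (hD1a : ρr₁ > α / (2 * δ))
    (hD2a : ρr₁ > 3 * α / (4 * (1 + β) ^ 2 * R) *
      (gfun (4 * R / (3 * Kmax ρr₁ (β * ρr₁) (μ * ρr₁) T))) ^ 2)
    (hD3a : ρr₁ < α / (1 + β) ^ 2 * (gfun R) ^ 2 / R)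
    (hD1b : ρr₂ > α / (2 * δ))
    (hD2b : ρr₂ > 3 * α / (4 * (1 + β) ^ 2 * R) *
      (gfun (4 * R / (3 * Kmax ρr₂ (β * ρr₂) (μ * ρr₂) T))) ^ 2)
    (hD3b : ρr₂ < α / (1 + β) ^ 2 * (gfun R) ^ 2 / R) :
    R / x₂ < R / x₁ ∧
      R / x₂ + Real.sqrt (R / x₂) * Real.sqrt (α * ((2:ℝ) ^ (R / (R / x₂)) - 1) / ρr₂) <
        R / x₁ + Real.sqrt (R / x₁) * Real.sqrt (α * ((2:ℝ) ^ (R / (R / x₁)) - 1) / ρr₁) := by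
  have hβ' : 0 < 1 + β := by linarith
  have hα' : 0 < α := by linarith
  have hρr₂ : 0 < ρr₂ := hρr₁.trans h12
  have hsq₁ : gfun x₁ ^ 2 = (1 + β) ^ 2 * (R * ρr₁ / α) := by
    rw [hgx₁, mul_pow, Real.sq_sqrt (by positivity)]
  have hsq₂ : gfun x₂ ^ 2 = (1 + β) ^ 2 * (R * ρr₂ / α) := by
    rw [hgx₂, mul_pow, Real.sq_sqrt (by positivity)]
  have hx : x₁ < x₂ := by
    refine (gfun_sq_strictMonoOn.lt_iff_lt hx₁ hx₂).mp ?_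
    simp only [hsq₁, hsq₂]
    gcongr
  have hK : R / x₂ < R / x₁ := by gcongr
  refine ⟨hK, ?_⟩
  rw [div_div_cancel₀ hR.ne', div_div_cancel₀ hR.ne',
    sqrt_mul_sqrt_eq_of_gfun_eq hR hα' hβ' hρr₁ hx₁ hsq₁,
    sqrt_mul_sqrt_eq_of_gfun_eq hR hα' hβ' hρr₂ hx₂ hsq₂]
  have hφ := gfunFactor_strictMonoOn hx₁ hx₂ hx
  have hφ₁ := gfunFactor_pos hx₁
  have hM : (1 + β) * R / (x₂ * gfunFactor x₂) < (1 + β) * R / (x₁ * gfunFactor x₁) := by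
    gcongr
  exact add_lt_add hK hM
end
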